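/- Let d ≥ 3, v : ℝ^d → ℝ bounded measurable with bounded support, and define Y_x(t) = ∫₀^t v(W_x(s)) ds and Y_x = Y_x(∞). Suppose x_n → x in ℝ^d and t_n → ∞. Then for every nonnegative integer k, E[(Y_{x_n}(t_n))^k] → E[(Y_x)^k], and for every α with |α| < α₀ (where α₀ is the uniform exponential integrability threshold from Lemma 1), E[exp(α Y_{x_n}(t_n))] → E[exp(α Y_x)]. -/

import Mathlib

open MeasureTheory Real Filter Topology ProbabilityTheory

noncomputable section

/-- Euclidean space `ℝ^d`. -/
abbrev Euc (d : ℕ) := EuclideanSpace ℝ (Fin d)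

/-- The Brownian transition density `q(s; w) = (2πs)^{-d/2} exp(-|w|²/(2s))`. -/
def heatKernel (d : ℕ) (s : ℝ) (w : Euc d) : ℝ :=
  (2 * π * s) ^ (-(d : ℝ) / 2) * Real.exp (-‖w‖ ^ 2 / (2 * s))

/-- Joint density of a Brownian motion started at `x`, at times `s 0 < s 1 < ⋯`. -/
def jointDensity (d : ℕ) {k : ℕ} (x : Euc d) (s : Fin k → ℝ) (z : Fin k → Euc d) : ℝ :=
  ∏ j : Fin k,
    heatKernel d (s j - if (j : ℕ) = 0 then 0 else s ⟨(j : ℕ) - 1, lt_of_le_of_lt (Nat.sub_le _ _) j.isLt⟩)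
      (z j - if (j : ℕ) = 0 then x else z ⟨(j : ℕ) - 1, lt_of_le_of_lt (Nat.sub_le _ _) j.isLt⟩)

/-- Joint density of the Brownian bridge from `a` to `b` in time `t`, at interior times `s`. -/
def bridgeDensity (d : ℕ) {k : ℕ} (t : ℝ) (a b : Euc d) (s : Fin k → ℝ) (z : Fin k → Euc d) : ℝ :=
  jointDensity d a (Fin.snoc s t) (Fin.snoc z b) / heatKernel d t (b - a)

/-- The open ordered simplex `0 < s₁ < ⋯ < s_k < t`. -/
def simplex (k : ℕ) (t : ℝ) : Set (Fin k → ℝ) :=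
  {s | StrictMono s ∧ ∀ i, 0 < s i ∧ s i < t}

/-- `W` is a standard `d`-dimensional Brownian motion started at `x`, characterized by
continuous paths and finite-dimensional densities given by products of heat kernels. -/
def IsBrownianMotion {Ω : Type*} [MeasureSpace Ω] {d : ℕ} (x : Euc d)
    (W : ℝ → Ω → Euc d) : Prop :=
  (∀ ω, W 0 ω = x) ∧ (∀ ω, Continuous fun s => W s ω) ∧
  ∀ (k : ℕ) (s : Fin (k + 1) → ℝ), StrictMono s → (∀ i, 0 < s i) →
    Measure.map (fun ω (i : Fin (k + 1)) => W (s i) ω) (ℙ : Measure Ω) =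
      (volume : Measure (Fin (k + 1) → Euc d)).withDensity
        (fun z => ENNReal.ofReal (jointDensity d x s z))

/-- `X` is a `d`-dimensional Brownian bridge from `a` to `b` in time `t`. -/
def IsBrownianBridge {Ω : Type*} [MeasureSpace Ω] {d : ℕ} (t : ℝ) (a b : Euc d)
    (X : ℝ → Ω → Euc d) : Prop :=
  (∀ ω, X 0 ω = a) ∧ (∀ ω, X t ω = b) ∧
  (∀ ω, ContinuousOn (fun s => X s ω) (Set.Icc 0 t)) ∧
  ∀ (k : ℕ) (s : Fin (k + 1) → ℝ), StrictMono s → (∀ i, 0 < s i ∧ s i < t) →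
    Measure.map (fun ω (i : Fin (k + 1)) => X (s i) ω) (ℙ : Measure Ω) =
      (volume : Measure (Fin (k + 1) → Euc d)).withDensity
        (fun z => ENNReal.ofReal (bridgeDensity d t a b s z))

/-- The path integral `∫₀^t v(X_s) ds`. -/
def pathInt {Ω : Type*} {d : ℕ} (v : Euc d → ℝ) (X : ℝ → Ω → Euc d) (t : ℝ) (ω : Ω) : ℝ :=
  ∫ s in Set.Ioc (0 : ℝ) t, v (X s ω)

/-- The total path integral `∫₀^∞ v(X_s) ds`. -/
def pathIntInf {Ω : Type*} {d : ℕ} (v : Euc d → ℝ) (X : ℝ → Ω → Euc d) (ω : Ω) : ℝ :=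
  ∫ s in Set.Ioi (0 : ℝ), v (X s ω)

/-- The density ratio `Q_{j} = q(t; y - x)/q(Δ_j s; Δ_j z)` with the conventions
`s₀ = 0`, `s_{k+1} = t`, `z₀ = x`, `z_{k+1} = y`. -/
def Qratio (d : ℕ) {k : ℕ} (t : ℝ) (x y : Euc d) (s : Fin k → ℝ) (z : Fin k → Euc d)
    (j : Fin (k + 1)) : ℝ :=
  heatKernel d t (y - x) /
    heatKernel d
      ((Fin.cons 0 (Fin.snoc s t) : Fin (k + 2) → ℝ) j.succ -
        (Fin.cons 0 (Fin.snoc s t) : Fin (k + 2) → ℝ) j.castSucc)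
      ((Fin.cons x (Fin.snoc z y) : Fin (k + 2) → Euc d) j.succ -
        (Fin.cons x (Fin.snoc z y) : Fin (k + 2) → Euc d) j.castSucc)

section HeatKernel

variable {d : ℕ}

theorem heatKernel_pos {s : ℝ} (hs : 0 < s) (w : Euc d) : 0 < heatKernel d s w := by
  unfold heatKernel
  positivity

theorem continuous_heatKernel (s : ℝ) : Continuous (heatKernel d s) := by
  unfold heatKernel
  fun_prop

theorem jointDensity_pos {k : ℕ} (a : Euc d) {s : Fin k → ℝ} (hs : StrictMono s)
    (hpos : ∀ i, 0 < s i) (z : Fin k → Euc d) : 0 < jointDensity d a s z := by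
  refine Finset.prod_pos fun j _ => heatKernel_pos ?_ _
  split_ifs with h
  · simpa using hpos j
  · rw [sub_pos]
    refine hs (Fin.lt_def.2 ?_)
    simp only
    omega

theorem continuous_jointDensity {k : ℕ} (a : Euc d) (s : Fin k → ℝ) :
    Continuous (jointDensity d a s) := by
  refine continuous_finsetProd _ fun j _ => (continuous_heatKernel _).comp ?_
  split_ifs <;> fun_prop

theorem jointDensity_one (a : Euc d) (s : Fin 1 → ℝ) (z : Fin 1 → Euc d) :
    jointDensity d a s z = heatKernel d (s 0) (z 0 - a) := by
  simp [jointDensity]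

/-- Changing the starting point only affects the first factor of the joint density. -/
theorem jointDensity_eq_ratio_mul {k : ℕ} (a b : Euc d) {s : Fin (k + 1) → ℝ} (h0 : 0 < s 0)
    (z : Fin (k + 1) → Euc d) :
    jointDensity d a s z =
      heatKernel d (s 0) (z 0 - a) / heatKernel d (s 0) (z 0 - b) * jointDensity d b s z := by
  have hb := (heatKernel_pos h0 (z 0 - b)).ne'
  simp only [jointDensity, Fin.prod_univ_succ, Fin.val_zero, if_true, sub_zero, Fin.val_succ,
    Nat.succ_ne_zero, if_false]
  field_simp

end HeatKernel

section Marginals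

variable {d : ℕ} {Ω : Type*} [MeasureSpace Ω] {a b : Euc d} {X Y : ℝ → Ω → Euc d}

theorem IsBrownianMotion.aemeasurable_tuple (hX : IsBrownianMotion a X) {k : ℕ}
    {s : Fin (k + 1) → ℝ} (hs : StrictMono s) (hpos : ∀ i, 0 < s i) :
    AEMeasurable (fun ω (i : Fin (k + 1)) => X (s i) ω) (ℙ : Measure Ω) := by
  by_contra h
  have hmap := hX.2.2 k s hs hpos
  rw [Measure.map_of_not_aemeasurable h, eq_comm, withDensity_eq_zero_iff
    (continuous_jointDensity a s).measurable.ennreal_ofReal.aemeasurable] at hmap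
  have hfalse : ∀ᵐ _ : Fin (k + 1) → Euc d, False := by
    filter_upwards [hmap] with z hz
    exact absurd hz (ENNReal.ofReal_pos.2 (jointDensity_pos a hs hpos z)).ne'
  exact hfalse.exists.elim fun _ h => h

theorem IsBrownianMotion.aemeasurable (hX : IsBrownianMotion a X) {s : ℝ} (hs : 0 ≤ s) :
    AEMeasurable (X s) (ℙ : Measure Ω) := by
  rcases hs.eq_or_lt with rfl | hs
  · rw [show X 0 = fun _ => a from funext hX.1]
    exact aemeasurable_const
  · exact (measurable_pi_apply (0 : Fin 1)).comp_aemeasurable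
      (hX.aemeasurable_tuple (k := 0) (s := fun _ => s) (Subsingleton.strictMono (α := Fin 1) _) fun _ => hs)

theorem IsBrownianMotion.lintegral_tuple (hX : IsBrownianMotion a X) {k : ℕ}
    {s : Fin (k + 1) → ℝ} (hs : StrictMono s) (hpos : ∀ i, 0 < s i)
    {H : (Fin (k + 1) → Euc d) → ENNReal} (hH : Measurable H) :
    ∫⁻ ω, H (fun i => X (s i) ω) = ∫⁻ z, ENNReal.ofReal (jointDensity d a s z) * H z := by
  rw [← lintegral_map' (f := H) hH.aemeasurable (hX.aemeasurable_tuple hs hpos),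
    hX.2.2 k s hs hpos, lintegral_withDensity_eq_lintegral_mul _
      (continuous_jointDensity a s).measurable.ennreal_ofReal hH]
  rfl

theorem IsBrownianMotion.lintegral_marginal (hX : IsBrownianMotion a X) {s : ℝ} (hs : 0 < s)
    {H : Euc d → ENNReal} (hH : Measurable H) :
    ∫⁻ ω, H (X s ω) = ∫⁻ z, ENNReal.ofReal (heatKernel d s (z - a)) * H z := by
  have h := hX.lintegral_tuple (k := 0) (s := fun _ => s) (Subsingleton.strictMono (α := Fin 1) _)
    (fun _ => hs) (H := fun z => H (z 0)) (by fun_prop)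
  simp only [jointDensity_one] at h
  rw [h]
  exact (volume_preserving_funUnique (Fin 1) (Euc d)).lintegral_comp
    (f := fun z => ENNReal.ofReal (heatKernel d s (z - a)) * H z)
    (((continuous_heatKernel s).measurable.comp (by fun_prop)).ennreal_ofReal.mul hH)

/-- The likelihood ratio at time `ε` of the Brownian motions started at `a` and `b`. -/
def startRatio (d : ℕ) (ε : ℝ) (a b z : Euc d) : ℝ :=
  heatKernel d ε (z - a) / heatKernel d ε (z - b)

theorem startRatio_pos {ε : ℝ} (hε : 0 < ε) (a b z : Euc d) : 0 < startRatio d ε a b z :=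
  div_pos (heatKernel_pos hε _) (heatKernel_pos hε _)

theorem measurable_startRatio (ε : ℝ) (a b : Euc d) : Measurable (startRatio d ε a b) :=
  ((continuous_heatKernel ε).measurable.comp (by fun_prop)).div
    ((continuous_heatKernel ε).measurable.comp (by fun_prop))

theorem IsBrownianMotion.lintegral_tuple_eq_startRatio (hX : IsBrownianMotion a X)
    (hY : IsBrownianMotion b Y) {k : ℕ}
    {s : Fin (k + 1) → ℝ} (hs : StrictMono s) (hpos : ∀ i, 0 < s i)
    {H : (Fin (k + 1) → Euc d) → ENNReal} (hH : Measurable H) :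
    ∫⁻ ω, H (fun i => X (s i) ω) =
      ∫⁻ ω, ENNReal.ofReal (startRatio d (s 0) a b (Y (s 0) ω)) * H (fun i => Y (s i) ω) := by
  rw [hX.lintegral_tuple hs hpos hH,
    hY.lintegral_tuple hs hpos (H := fun z => ENNReal.ofReal (startRatio d (s 0) a b (z 0)) * H z)
      (((measurable_startRatio _ a b).comp (measurable_pi_apply 0)).ennreal_ofReal.mul hH)]
  refine lintegral_congr fun z => ?_
  rw [jointDensity_eq_ratio_mul a b (hpos 0), ← startRatio,
    ENNReal.ofReal_mul (startRatio_pos (hpos 0) a b (z 0)).le]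
  ring

end Marginals

section Grid

variable {d : ℕ} {Ω : Type*}

/-- The countable dense grid of times `ε + k / (m + 1)`. -/
def gridTime (ε : ℝ) (i : ℕ × ℕ) : ℝ := ε + i.1 / (i.2 + 1)

/-- The restriction of a path to the time grid. -/
def gridPath (ε : ℝ) (X : ℝ → Ω → Euc d) (ω : Ω) (i : ℕ × ℕ) : Euc d := X (gridTime ε i) ω

/-- Recover the value at time `s` of a right-continuous path from its values on the grid. -/
def gridExtend (ε : ℝ) (p : ℕ × ℕ → Euc d) (s : ℝ) : Euc d :=
  limUnder atTop fun m : ℕ => p (⌈(s - ε) * (m + 1)⌉₊, m)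

theorem le_gridTime (ε : ℝ) (i : ℕ × ℕ) : ε ≤ gridTime ε i := by
  unfold gridTime
  have : (0 : ℝ) ≤ i.1 / (i.2 + 1) := by positivity
  linarith

theorem gridTime_zero (ε : ℝ) : gridTime ε (0, 0) = ε := by simp [gridTime]

theorem tendsto_gridTime {ε s : ℝ} (hs : ε ≤ s) :
    Tendsto (fun m : ℕ => gridTime ε (⌈(s - ε) * (m + 1)⌉₊, m)) atTop (𝓝 s) := by
  have hupper : Tendsto (fun m : ℕ => s + 1 / ((m : ℝ) + 1)) atTop (𝓝 s) := by
    simpa using tendsto_one_div_add_atTop_nhds_zero_nat.const_add s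
  refine tendsto_of_tendsto_of_tendsto_of_le_of_le tendsto_const_nhds hupper
    (fun m => ?_) fun m => ?_
  · have hm : (0 : ℝ) < m + 1 := by positivity
    have := (le_div_iff₀ hm).2 (Nat.le_ceil ((s - ε) * ((m : ℝ) + 1)))
    simp only [gridTime]
    linarith
  · have hm : (0 : ℝ) < m + 1 := by positivity
    have h0 : 0 ≤ (s - ε) * ((m : ℝ) + 1) := mul_nonneg (by linarith) hm.le
    have := (div_le_div_iff_of_pos_right hm).2 (Nat.ceil_lt_add_one h0).le
    rw [add_div, mul_div_assoc, div_self hm.ne', mul_one] at this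
    simp only [gridTime]
    linarith

theorem gridExtend_gridPath {ε s : ℝ} (hs : ε ≤ s) {X : ℝ → Ω → Euc d} {ω : Ω}
    (hX : Continuous fun s => X s ω) : gridExtend ε (gridPath ε X ω) s = X s ω :=
  ((hX.tendsto s).comp (tendsto_gridTime hs)).limUnder_eq

theorem stronglyMeasurable_gridExtend (ε : ℝ) :
    StronglyMeasurable fun q : (ℕ × ℕ → Euc d) × ℝ => gridExtend ε q.1 q.2 := by
  refine StronglyMeasurable.limUnder fun m => ?_
  have heval : Measurable fun q : (ℕ × ℕ → Euc d) × ℕ => q.1 (q.2, m) :=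
    measurable_from_prod_countable_left fun k => measurable_pi_apply (k, m)
  exact (heval.comp (measurable_fst.prodMk
    (Nat.measurable_ceil.comp (by fun_prop : Measurable fun q : (ℕ × ℕ → Euc d) × ℝ =>
      (q.2 - ε) * ((m : ℝ) + 1))))).stronglyMeasurable

/-- The integral over the time set `S` of `v` along the path reconstructed from the grid. -/
def gridInt (v : Euc d → ℝ) (ε : ℝ) (S : Set ℝ) (p : ℕ × ℕ → Euc d) : ℝ :=
  ∫ s in S, v (gridExtend ε p s)

theorem measurable_gridInt {v : Euc d → ℝ} (hv : Measurable v) (ε : ℝ) (S : Set ℝ) :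
    Measurable (gridInt v ε S) :=
  (StronglyMeasurable.integral_prod_right (f := fun p s => v (gridExtend ε p s))
    (hv.comp (stronglyMeasurable_gridExtend ε).measurable).stronglyMeasurable).measurable

theorem gridInt_gridPath (v : Euc d → ℝ) {ε : ℝ} {S : Set ℝ} (hS : MeasurableSet S)
    (hSε : S ⊆ Set.Ioi ε) {X : ℝ → Ω → Euc d} {ω : Ω} (hX : Continuous fun s => X s ω) :
    gridInt v ε S (gridPath ε X ω) = ∫ s in S, v (X s ω) :=
  setIntegral_congr_fun hS fun s hs => by
    simp only [gridExtend_gridPath (hSε hs).le hX]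

end Grid

section PathLaw

variable {d : ℕ} {Ω : Type*} [MeasureSpace Ω] {a b : Euc d} {X Y : ℝ → Ω → Euc d}

theorem IsBrownianMotion.aemeasurable_gridPath (hX : IsBrownianMotion a X) {ε : ℝ} (hε : 0 ≤ ε) :
    AEMeasurable (gridPath ε X) (ℙ : Measure Ω) :=
  aemeasurable_pi_iff.2 fun i => hX.aemeasurable (hε.trans (le_gridTime ε i))

theorem IsBrownianMotion.aemeasurable_setIntegral (hX : IsBrownianMotion a X) {v : Euc d → ℝ}
    (hv : Measurable v) {S : Set ℝ} (hS : MeasurableSet S) (hS0 : S ⊆ Set.Ioi 0) :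
    AEMeasurable (fun ω => ∫ s in S, v (X s ω)) (ℙ : Measure Ω) := by
  simp_rw [← gridInt_gridPath v hS hS0 (hX.2.1 _)]
  exact (measurable_gridInt hv 0 S).comp_aemeasurable (hX.aemeasurable_gridPath le_rfl)

variable [IsProbabilityMeasure (ℙ : Measure Ω)]

/-- After time `ε`, the laws of Brownian motions with different starting points are mutually
absolutely continuous, with density the likelihood ratio at time `ε`. -/
theorem IsBrownianMotion.map_gridPath_eq_withDensity (hX : IsBrownianMotion a X)
    (hY : IsBrownianMotion b Y) {ε : ℝ} (hε : 0 < ε) :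
    Measure.map (gridPath ε X) (ℙ : Measure Ω) =
      (Measure.map (gridPath ε Y) (ℙ : Measure Ω)).withDensity
        fun p => ENNReal.ofReal (startRatio d ε a b (p (0, 0))) := by
  have hXm := hX.aemeasurable_gridPath hε.le
  have hYm := hY.aemeasurable_gridPath hε.le
  have hr : Measurable fun p : ℕ × ℕ → Euc d => ENNReal.ofReal (startRatio d ε a b (p (0, 0))) :=
    ((measurable_startRatio ε a b).comp (measurable_pi_apply (0, 0))).ennreal_ofReal
  have := Measure.isProbabilityMeasure_map hXm
  refine IsProjectiveLimit.unique (P := fun I : Finset (ℕ × ℕ) =>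
    (Measure.map (gridPath ε X) (ℙ : Measure Ω)).map I.restrict) (fun _ => rfl) fun I => ?_
  obtain ⟨F, hF⟩ : ∃ F : Finset ℝ, F = insert ε (I.image (gridTime ε)) := ⟨_, rfl⟩
  have hεF : ε ∈ F := by simp [hF]
  have hFle : ∀ u ∈ F, ε ≤ u := by
    intro u hu
    rw [hF, Finset.mem_insert, Finset.mem_image] at hu
    rcases hu with rfl | ⟨i, -, rfl⟩
    · exact le_rfl
    · exact le_gridTime ε i
  obtain ⟨k, hk⟩ : ∃ k, F.card = k + 1 :=
    Nat.exists_eq_succ_of_ne_zero (Finset.card_pos.2 ⟨ε, hεF⟩).ne'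
  set s := F.orderEmbOfFin hk with hs
  have hsF : ∀ j, s j ∈ F := F.orderEmbOfFin_mem hk
  have hpos : ∀ j, 0 < s j := fun j => hε.trans_le (hFle _ (hsF j))
  have hidx : ∀ u ∈ F, ∃ j, s j = u := by
    intro u hu
    have : u ∈ Set.range s := by rw [hs, Finset.range_orderEmbOfFin]; exact hu
    exact this
  have hs0 : s 0 = ε := by
    obtain ⟨j, hj⟩ := hidx ε hεF
    exact le_antisymm (hj ▸ s.monotone (Fin.zero_le j)) (hFle _ (hsF 0))
  have hidxI : ∀ i : I, ∃ j, s j = gridTime ε i := fun i =>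
    hidx _ (by rw [hF]; exact Finset.mem_insert_of_mem (Finset.mem_image_of_mem _ i.2))
  choose idx hidx' using hidxI
  have hproj : Measurable fun (z : Fin (k + 1) → Euc d) (i : I) => z (idx i) := by fun_prop
  have hrestrict : ∀ (Z : ℝ → Ω → Euc d) (ω : Ω),
      I.restrict (gridPath ε Z ω) = fun i : I => Z (s (idx i)) ω := by
    intro Z ω
    ext1 i
    simp [gridPath, hidx']
  ext A hA
  have hind : Measurable (A.indicator (1 : (I → Euc d) → ENNReal)) :=
    measurable_one.indicator hA
  have hres := Finset.measurable_restrict (X := fun _ : ℕ × ℕ => Euc d) I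
  have hcomp : Measurable fun p : ℕ × ℕ → Euc d =>
      A.indicator (1 : (I → Euc d) → ENNReal) (I.restrict p) := hind.comp hres
  rw [← lintegral_indicator_one hA, ← lintegral_indicator_one hA,
    lintegral_map hind hres, lintegral_map hind hres,
    lintegral_withDensity_eq_lintegral_mul _ hr hcomp,
    lintegral_map' (hr.mul hcomp).aemeasurable hYm, lintegral_map' hcomp.aemeasurable hXm]
  simp only [Pi.mul_apply, hrestrict]
  rw [hX.lintegral_tuple_eq_startRatio hY s.strictMono hpos
    (H := fun z => A.indicator 1 fun i : I => z (idx i)) (hind.comp hproj)]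
  simp only [gridPath, gridTime_zero, hs0]

theorem IsBrownianMotion.integral_gridPath_eq (hX : IsBrownianMotion a X)
    (hY : IsBrownianMotion b Y) {ε : ℝ} (hε : 0 < ε) {G : (ℕ × ℕ → Euc d) → ℝ}
    (hG : Measurable G) :
    ∫ ω, G (gridPath ε X ω) = ∫ ω, startRatio d ε a b (Y ε ω) * G (gridPath ε Y ω) := by
  have hr : Measurable fun p : ℕ × ℕ → Euc d => startRatio d ε a b (p (0, 0)) :=
    (measurable_startRatio ε a b).comp (measurable_pi_apply (0, 0))
  rw [← integral_map (hX.aemeasurable_gridPath hε.le) hG.aestronglyMeasurable,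
    hX.map_gridPath_eq_withDensity hY hε,
    integral_withDensity_eq_integral_toReal_smul hr.ennreal_ofReal
      (Eventually.of_forall fun _ => ENNReal.ofReal_lt_top),
    integral_map (f := fun p => (ENNReal.ofReal (startRatio d ε a b (p (0, 0)))).toReal • G p)
      (hY.aemeasurable_gridPath hε.le) (hr.ennreal_ofReal.ennreal_toReal.smul hG).aestronglyMeasurable]
  refine integral_congr_ae (Eventually.of_forall fun ω => ?_)
  simp only [gridPath, gridTime_zero, smul_eq_mul]
  rw [ENNReal.toReal_ofReal (startRatio_pos hε a b _).le]

end PathLaw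

section Integrability

variable {d : ℕ} {Ω : Type*} [MeasureSpace Ω] {a : Euc d} {X : ℝ → Ω → Euc d}
  {v : Euc d → ℝ} {C R : ℝ}

theorem integrable_of_bounded_of_bounded_support (hv : Measurable v) (hC : ∀ z, |v z| ≤ C)
    (hR : ∀ z, v z ≠ 0 → ‖z‖ ≤ R) : Integrable v := by
  rw [← integrableOn_iff_integrable_of_support_subset
    (s := Metric.closedBall (0 : Euc d) R) fun z hz => by simpa using hR z hz]
  exact Measure.integrableOn_of_bounded (M := C) measure_closedBall_lt_top.ne
    hv.aestronglyMeasurable (Eventually.of_forall hC)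

theorem heatKernel_le_rpow (hd : 3 ≤ d) {s : ℝ} (hs : 1 ≤ s) (w : Euc d) :
    heatKernel d s w ≤ s ^ (-3 / 2 : ℝ) := by
  have hs0 : 0 < s := by linarith
  have hd' : (3 : ℝ) ≤ d := by exact_mod_cast hd
  have h1 : s ≤ 2 * π * s := by nlinarith [Real.pi_gt_three]
  have hexp : Real.exp (-‖w‖ ^ 2 / (2 * s)) ≤ 1 :=
    Real.exp_le_one_iff.2 (div_nonpos_of_nonpos_of_nonneg (by nlinarith [norm_nonneg w])
      (by positivity))
  calc heatKernel d s w ≤ (2 * π * s) ^ (-(d : ℝ) / 2) * 1 := by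
        unfold heatKernel; gcongr
    _ ≤ s ^ (-(d : ℝ) / 2) := by
        rw [mul_one]
        exact Real.rpow_le_rpow_of_nonpos hs0 h1 (by linarith)
    _ ≤ s ^ (-3 / 2 : ℝ) := Real.rpow_le_rpow_of_exponent_le hs (by linarith)

theorem IsBrownianMotion.lintegral_enorm_le (hX : IsBrownianMotion a X) (hd : 3 ≤ d)
    (hv : Measurable v) {s : ℝ} (hs : 1 ≤ s) :
    ∫⁻ ω, ‖v (X s ω)‖ₑ ≤ ENNReal.ofReal (s ^ (-3 / 2 : ℝ)) * ∫⁻ z, ‖v z‖ₑ := by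
  rw [hX.lintegral_marginal (H := fun z => ‖v z‖ₑ) (by linarith) hv.enorm,
    ← lintegral_const_mul _ hv.enorm]
  gcongr with z
  exact heatKernel_le_rpow hd hs _

variable [IsProbabilityMeasure (ℙ : Measure Ω)] in
/-- In dimension at least three, the occupation integrals of Brownian motion are finite. -/
theorem IsBrownianMotion.ae_integrableOn_Ioi (hX : IsBrownianMotion a X) (hd : 3 ≤ d)
    (hv : Measurable v) (hC : ∀ z, |v z| ≤ C) (hR : ∀ z, v z ≠ 0 → ‖z‖ ≤ R) :
    ∀ᵐ ω ∂(ℙ : Measure Ω), IntegrableOn (fun s => v (X s ω)) (Set.Ioi 0) := by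
  have hXm := hX.aemeasurable_gridPath zero_le_one
  have hjoint : Measurable fun q : (ℕ × ℕ → Euc d) × ℝ => ‖v (gridExtend 1 q.1 q.2)‖ₑ :=
    (hv.comp (stronglyMeasurable_gridExtend 1).measurable).enorm
  have hmeas : Measurable fun p : ℕ × ℕ → Euc d => ∫⁻ s in Set.Ioi 1, ‖v (gridExtend 1 p s)‖ₑ :=
    hjoint.lintegral_prod_right'
  have hfin : ∫⁻ p, (∫⁻ s in Set.Ioi (1 : ℝ), ‖v (gridExtend 1 p s)‖ₑ)
      ∂(Measure.map (gridPath 1 X) (ℙ : Measure Ω)) ≠ ⊤ := by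
    rw [lintegral_lintegral_swap hjoint.aemeasurable]
    have hpow : ∫⁻ s in Set.Ioi (1 : ℝ), ENNReal.ofReal (s ^ (-3 / 2 : ℝ)) ≠ ⊤ :=
      (integrableOn_Ioi_rpow_of_lt (by norm_num) one_pos).lintegral_lt_top.ne
    refine ne_top_of_le_ne_top (ENNReal.mul_ne_top hpow
      (integrable_of_bounded_of_bounded_support hv hC hR).2.ne) ?_
    rw [← lintegral_mul_const _ (by fun_prop)]
    refine setLIntegral_mono' measurableSet_Ioi fun s hs => ?_
    rw [lintegral_map' (f := fun p => ‖v (gridExtend 1 p s)‖ₑ)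
      (hjoint.comp (measurable_id.prodMk measurable_const)).aemeasurable hXm]
    simp_rw [gridExtend_gridPath (Set.mem_Ioi.1 hs).le (hX.2.1 _)]
    exact hX.lintegral_enorm_le hd hv (Set.mem_Ioi.1 hs).le
  filter_upwards [ae_of_ae_map hXm (ae_lt_top hmeas hfin)] with ω hω
  have hvX : Measurable fun s => v (X s ω) := hv.comp (hX.2.1 ω).measurable
  rw [← Set.Ioc_union_Ioi_eq_Ioi zero_le_one]
  refine IntegrableOn.union (Measure.integrableOn_of_bounded (M := C) (by simp)
    hvX.aestronglyMeasurable (Eventually.of_forall fun s => hC _))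
    ⟨hvX.aestronglyMeasurable, ?_⟩
  refine lt_of_le_of_lt (le_of_eq ?_) hω
  refine setLIntegral_congr_fun measurableSet_Ioi fun s hs => ?_
  simp only [gridExtend_gridPath (Set.mem_Ioi.1 hs).le (hX.2.1 ω)]

theorem integrable_exp_neg_mul_sq_norm {c : ℝ} (hc : 0 < c) :
    Integrable fun w : Euc d => Real.exp (-c * ‖w‖ ^ 2) := by
  have h := (GaussianFourier.integrable_cexp_neg_mul_sq_norm_add (V := Euc d) (b := (c : ℂ))
    (by simpa using hc) 0 0).norm
  refine h.congr (Eventually.of_forall fun w => ?_)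
  simp [Complex.norm_exp, ← Complex.ofReal_pow]

theorem heatKernel_mul_exp_norm_le {ε : ℝ} (hε : 0 < ε) (c : ℝ) (w : Euc d) :
    heatKernel d ε w * Real.exp (c * ‖w‖) ≤
      (2 * π * ε) ^ (-(d : ℝ) / 2) * Real.exp (c ^ 2 * ε) *
        Real.exp (-(1 / (4 * ε)) * ‖w‖ ^ 2) := by
  unfold heatKernel
  rw [mul_assoc (_ ^ _), mul_assoc (_ ^ _), ← Real.exp_add, ← Real.exp_add]
  refine mul_le_mul_of_nonneg_left (Real.exp_le_exp.2 ?_) (by positivity)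
  have h : 0 ≤ (‖w‖ - 2 * c * ε) ^ 2 / (4 * ε) := by positivity
  have heq : c ^ 2 * ε + -(1 / (4 * ε)) * ‖w‖ ^ 2 - (-‖w‖ ^ 2 / (2 * ε) + c * ‖w‖) =
      (‖w‖ - 2 * c * ε) ^ 2 / (4 * ε) := by
    field_simp
    ring
  linarith

theorem IsBrownianMotion.integrable_exp_norm_sub (hX : IsBrownianMotion a X) {ε : ℝ}
    (hε : 0 < ε) (c : ℝ) :
    Integrable (fun ω => Real.exp (c * ‖X ε ω - a‖)) (ℙ : Measure Ω) := by
  have hmeas : AEMeasurable (fun ω => Real.exp (c * ‖X ε ω - a‖)) (ℙ : Measure Ω) := by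
    have := hX.aemeasurable hε.le
    fun_prop
  rw [← lintegral_ofReal_ne_top_iff_integrable hmeas.aestronglyMeasurable
    (Eventually.of_forall fun _ => (Real.exp_pos _).le),
    hX.lintegral_marginal (H := fun z => ENNReal.ofReal (Real.exp (c * ‖z - a‖))) hε
      (by fun_prop),
    lintegral_sub_right_eq_self (fun w : Euc d =>
      ENNReal.ofReal (heatKernel d ε w) * ENNReal.ofReal (Real.exp (c * ‖w‖))) a]
  refine ne_top_of_le_ne_top (((integrable_exp_neg_mul_sq_norm (d := d)
    (c := 1 / (4 * ε)) (by positivity)).const_mul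
    ((2 * π * ε) ^ (-(d : ℝ) / 2) * Real.exp (c ^ 2 * ε))).lintegral_lt_top).ne
    (lintegral_mono fun w => ?_)
  rw [← ENNReal.ofReal_mul (heatKernel_pos hε w).le]
  exact ENNReal.ofReal_le_ofReal (heatKernel_mul_exp_norm_le hε c w)

end Integrability

section StartRatio

variable {d : ℕ} {ε : ℝ} {a b : Euc d}

theorem startRatio_eq_exp (hε : 0 < ε) (z : Euc d) :
    startRatio d ε a b z = Real.exp ((‖z - b‖ ^ 2 - ‖z - a‖ ^ 2) / (2 * ε)) := by
  have h : (2 * π * ε) ^ (-(d : ℝ) / 2) ≠ 0 := by positivity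
  rw [startRatio, heatKernel, heatKernel, mul_div_mul_left _ _ h, ← Real.exp_sub]
  congr 1
  ring

theorem startRatio_le_exp_norm (hε : 0 < ε) (hab : ‖a - b‖ ≤ 1) (z : Euc d) :
    startRatio d ε a b z ≤ Real.exp (‖z - b‖ / ε) := by
  rw [startRatio_eq_exp hε, Real.exp_le_exp, div_le_div_iff₀ (by positivity) hε]
  have htri : ‖z - b‖ ≤ ‖z - a‖ + ‖a - b‖ := norm_sub_le_norm_sub_add_norm_sub z a b
  have hsq : ‖z - b‖ ^ 2 - ‖z - a‖ ^ 2 ≤ 2 * ‖z - b‖ := by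
    nlinarith [norm_nonneg (z - b), norm_nonneg (z - a), sq_nonneg (‖z - b‖ - ‖z - a‖)]
  nlinarith

theorem tendsto_startRatio (hε : 0 < ε) {a : ℕ → Euc d} (ha : Tendsto a atTop (𝓝 b))
    (z : Euc d) : Tendsto (fun n => startRatio d ε (a n) b z) atTop (𝓝 1) := by
  have hcont : Continuous fun a => Real.exp ((‖z - b‖ ^ 2 - ‖z - a‖ ^ 2) / (2 * ε)) := by
    fun_prop
  simp_rw [startRatio_eq_exp hε]
  simpa [Function.comp_def] using (hcont.tendsto b).comp ha

theorem exp_add_mul_le {u β β' : ℝ} (A : ℝ) (hβ : 0 ≤ β) (hββ' : β < β') :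
    Real.exp (u + β * A) ≤ Real.exp (β' * A) + Real.exp (β' / (β' - β) * u) := by
  have hpos : 0 < β' - β := sub_pos.2 hββ'
  rcases le_total u ((β' - β) * A) with h | h
  · exact (Real.exp_le_exp.2 (by linarith)).trans (le_add_of_nonneg_right (Real.exp_pos _).le)
  · refine (Real.exp_le_exp.2 ?_).trans (le_add_of_nonneg_left (Real.exp_pos _).le)
    rw [div_mul_eq_mul_div, le_div_iff₀ hpos]
    nlinarith [mul_le_mul_of_nonneg_left h hβ]

end StartRatio

section Convergence

variable {d : ℕ} {Ω : Type*} [MeasureSpace Ω] {a b : Euc d}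
  {X Y : ℝ → Ω → Euc d} {v : Euc d → ℝ} {C R K β β' ε : ℝ} {f : ℝ → ℝ}

theorem abs_setIntegral_le_setIntegral_abs {g : ℝ → ℝ} {S T : Set ℝ}
    (hST : S ⊆ T) (hg : IntegrableOn g T) :
    |∫ s in S, g s| ≤ ∫ s in T, |g s| :=
  (abs_integral_le_integral_abs).trans
    (setIntegral_mono_set hg.abs (Eventually.of_forall fun _ => abs_nonneg _)
      hST.eventuallyLE)

theorem tendsto_setIntegral_Ioc_atTop {g : ℝ → ℝ} (hg : IntegrableOn g (Set.Ioi ε))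
    {t : ℕ → ℝ} (ht : Tendsto t atTop atTop) :
    Tendsto (fun n => ∫ s in Set.Ioc ε (t n), g s) atTop (𝓝 (∫ s in Set.Ioi ε, g s)) := by
  refine (intervalIntegral_tendsto_integral_Ioi ε hg ht).congr' ?_
  filter_upwards [ht.eventually_ge_atTop ε] with n hn
  rw [intervalIntegral.integral_of_le hn]

theorem IsBrownianMotion.aestronglyMeasurable_exp (hX : IsBrownianMotion a X)
    (hv : Measurable v) {S : Set ℝ} (hS : MeasurableSet S) (hS0 : S ⊆ Set.Ioi 0) :
    AEStronglyMeasurable (fun ω => Real.exp (β * ∫ s in S, |v (X s ω)|)) (ℙ : Measure Ω) :=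
  (Real.measurable_exp.comp_aemeasurable
    ((hX.aemeasurable_setIntegral (v := fun z => |v z|) hv.norm hS hS0).const_mul
      β)).aestronglyMeasurable

theorem IsBrownianMotion.integrable_exp_of_lintegral_ne_top (hX : IsBrownianMotion a X)
    (hv : Measurable v)
    (h : ∫⁻ ω, ENNReal.ofReal (Real.exp (β * ∫ s in Set.Ioi (0 : ℝ), |v (X s ω)|)) ≠ ⊤) :
    Integrable (fun ω => Real.exp (β * ∫ s in Set.Ioi (0 : ℝ), |v (X s ω)|)) (ℙ : Measure Ω) := by
  rwa [← lintegral_ofReal_ne_top_iff_integrable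
    (hX.aestronglyMeasurable_exp hv measurableSet_Ioi subset_rfl)
    (Eventually.of_forall fun _ => (Real.exp_pos _).le)]

variable [IsProbabilityMeasure (ℙ : Measure Ω)]

/-- Convergence of expectations of functionals of the path after the positive time `ε`. -/
theorem tendsto_integral_comp_setIntegral_Ioc (hd : 3 ≤ d) (hv : Measurable v)
    (hC : ∀ z, |v z| ≤ C) (hR : ∀ z, v z ≠ 0 → ‖z‖ ≤ R) (hε : 0 < ε)
    {x : ℕ → Euc d} {W : ℕ → ℝ → Ω → Euc d} (hW : ∀ n, IsBrownianMotion (x n) (W n))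
    (hY : IsBrownianMotion b Y) (hx : Tendsto x atTop (𝓝 b))
    {t : ℕ → ℝ} (ht : Tendsto t atTop atTop)
    (hβ : 0 ≤ β) (hββ' : β < β')
    (hInt : Integrable (fun ω => Real.exp (β' * ∫ s in Set.Ioi (0 : ℝ), |v (Y s ω)|))
      (ℙ : Measure Ω))
    (hf : Continuous f) (hfK : ∀ y, |f y| ≤ K * Real.exp (β * |y|)) :
    Tendsto (fun n => ∫ ω, f (∫ s in Set.Ioc ε (t n), v (W n s ω))) atTop
      (𝓝 (∫ ω, f (∫ s in Set.Ioi ε, v (Y s ω)))) := by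
  have hK : 0 ≤ K := by
    have := (abs_nonneg _).trans (hfK 0)
    simpa using this
  have hIoc : ∀ n, Set.Ioc ε (t n) ⊆ Set.Ioi ε := fun n => Set.Ioc_subset_Ioi_self
  have hchange : ∀ n, ∫ ω, f (∫ s in Set.Ioc ε (t n), v (W n s ω)) =
      ∫ ω, startRatio d ε (x n) b (Y ε ω) * f (∫ s in Set.Ioc ε (t n), v (Y s ω)) := by
    intro n
    have h := (hW n).integral_gridPath_eq hY hε
      (hf.measurable.comp (measurable_gridInt hv ε (Set.Ioc ε (t n))))
    simpa only [Function.comp_apply, gridInt_gridPath v measurableSet_Ioc (hIoc n) ((hW n).2.1 _),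
      gridInt_gridPath v measurableSet_Ioc (hIoc n) (hY.2.1 _)] using h
  simp_rw [hchange]
  refine tendsto_integral_filter_of_dominated_convergence
    (fun ω => K * (Real.exp (β' * ∫ s in Set.Ioi (0 : ℝ), |v (Y s ω)|) +
      Real.exp (β' / (β' - β) / ε * ‖Y ε ω - b‖))) (Eventually.of_forall fun n => ?_) ?_
    ((hInt.add (hY.integrable_exp_norm_sub hε _)).const_mul K) ?_
  · have h1 := (measurable_startRatio ε (x n) b).comp_aemeasurable (hY.aemeasurable hε.le)
    have h2 := hf.measurable.comp_aemeasurable (hY.aemeasurable_setIntegral hv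
      (measurableSet_Ioc (a := ε) (b := t n)) ((hIoc n).trans (Set.Ioi_subset_Ioi hε.le)))
    exact (h1.mul h2).aestronglyMeasurable
  · filter_upwards [hx.eventually (Metric.closedBall_mem_nhds b one_pos)] with n hn
    filter_upwards [hY.ae_integrableOn_Ioi hd hv hC hR] with ω hω
    have hratio := startRatio_le_exp_norm hε (by simpa [dist_eq_norm] using hn) (Y ε ω)
    have habs : |∫ s in Set.Ioc ε (t n), v (Y s ω)| ≤ ∫ s in Set.Ioi (0 : ℝ), |v (Y s ω)| :=
      abs_setIntegral_le_setIntegral_abs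
        ((hIoc n).trans (Set.Ioi_subset_Ioi hε.le)) hω
    rw [norm_mul, Real.norm_of_nonneg (startRatio_pos hε _ _ _).le, Real.norm_eq_abs]
    calc startRatio d ε (x n) b (Y ε ω) * |f (∫ s in Set.Ioc ε (t n), v (Y s ω))|
        ≤ Real.exp (‖Y ε ω - b‖ / ε) *
          (K * Real.exp (β * ∫ s in Set.Ioi (0 : ℝ), |v (Y s ω)|)) := by
          gcongr
          exact (hfK _).trans (by gcongr)
      _ = K * Real.exp (‖Y ε ω - b‖ / ε + β * ∫ s in Set.Ioi (0 : ℝ), |v (Y s ω)|) := by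
          rw [Real.exp_add]; ring
      _ ≤ _ := by
          have h := exp_add_mul_le (u := ‖Y ε ω - b‖ / ε)
            (∫ s in Set.Ioi (0 : ℝ), |v (Y s ω)|) hβ hββ'
          rw [show β' / (β' - β) / ε * ‖Y ε ω - b‖ = β' / (β' - β) * (‖Y ε ω - b‖ / ε) by ring]
          gcongr
  · filter_upwards [hY.ae_integrableOn_Ioi hd hv hC hR] with ω hω
    have hlim := (hf.tendsto _).comp (tendsto_setIntegral_Ioc_atTop
      (hω.mono_set (Set.Ioi_subset_Ioi hε.le)) ht)
    simpa using (tendsto_startRatio hε hx (Y ε ω)).mul hlim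

/-- Discarding the initial time interval `(0, ε]` costs `O(ε)`. -/
theorem IsBrownianMotion.abs_integral_sub_integral_le (hX : IsBrownianMotion a X) (hd : 3 ≤ d)
    (hv : Measurable v) (hC : ∀ z, |v z| ≤ C) (hR : ∀ z, v z ≠ 0 → ‖z‖ ≤ R) (hε : 0 ≤ ε)
    {S : Set ℝ} (hS : MeasurableSet S) (hS0 : S ⊆ Set.Ioi 0) (hβ : 0 ≤ β) (hK : 0 ≤ K)
    (hInt : Integrable (fun ω => Real.exp (β * ∫ s in Set.Ioi (0 : ℝ), |v (X s ω)|))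
      (ℙ : Measure Ω))
    (hf : Continuous f) (hfK : ∀ y, |f y| ≤ K * Real.exp (β * |y|))
    (hfL : ∀ A y z, |y| ≤ A → |z| ≤ A → |f y - f z| ≤ K * |y - z| * Real.exp (β * A)) :
    |(∫ ω, f (∫ s in S, v (X s ω))) - ∫ ω, f (∫ s in S ∩ Set.Ioi ε, v (X s ω))| ≤
      K * (C * ε) * ∫ ω, Real.exp (β * ∫ s in S, |v (X s ω)|) := by
  have hC0 : 0 ≤ C := (abs_nonneg _).trans (hC 0)
  have hSε := hS.inter (measurableSet_Ioi (a := ε))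
  have hae := hX.ae_integrableOn_Ioi hd hv hC hR
  have hintf : ∀ T : Set ℝ, MeasurableSet T → T ⊆ Set.Ioi 0 →
      Integrable (fun ω => f (∫ s in T, v (X s ω))) (ℙ : Measure Ω) := by
    intro T hT hT0
    refine (hInt.const_mul K).mono'
      (hf.measurable.comp_aemeasurable
        (hX.aemeasurable_setIntegral hv hT hT0)).aestronglyMeasurable ?_
    filter_upwards [hae] with ω hω
    refine (hfK _).trans ?_
    have := abs_setIntegral_le_setIntegral_abs hT0 hω
    gcongr
  have hintS : Integrable (fun ω => Real.exp (β * ∫ s in S, |v (X s ω)|)) (ℙ : Measure Ω) := by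
    refine hInt.mono' (hX.aestronglyMeasurable_exp hv hS hS0) ?_
    filter_upwards [hae] with ω hω
    rw [Real.norm_of_nonneg (Real.exp_pos _).le]
    have : ∫ s in S, |v (X s ω)| ≤ ∫ s in Set.Ioi 0, |v (X s ω)| :=
      setIntegral_mono_set hω.abs (Eventually.of_forall fun _ => abs_nonneg _) hS0.eventuallyLE
    gcongr
  rw [← integral_sub (hintf S hS hS0) (hintf _ hSε (Set.inter_subset_left.trans hS0)),
    ← integral_const_mul, ← Real.norm_eq_abs]
  refine norm_integral_le_of_norm_le (hintS.const_mul _) ?_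
  filter_upwards [hae] with ω hω
  have hωS : IntegrableOn (fun s => v (X s ω)) S := hω.mono_set hS0
  refine (hfL _ _ _ (abs_setIntegral_le_setIntegral_abs subset_rfl hωS)
    (abs_setIntegral_le_setIntegral_abs Set.inter_subset_left hωS)).trans ?_
  gcongr
  rw [← integral_inter_add_sdiff (measurableSet_Ioi (a := ε)) hωS, add_sub_cancel_left]
  have hsub : S \ Set.Ioi ε ⊆ Set.Ioc 0 ε := fun s hs => ⟨hS0 hs.1, by simpa using hs.2⟩
  have hvol : volume (S \ Set.Ioi ε) < ⊤ := (measure_mono hsub).trans_lt measure_Ioc_lt_top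
  refine (norm_setIntegral_le_of_norm_le_const (f := fun s => v (X s ω)) hvol
    fun s _ => hC _).trans ?_
  gcongr
  refine (measureReal_mono hsub (by simp)).trans ?_
  simp [hε]

/-- Convergence of expectations of a locally Lipschitz function of exponential growth of the
path integrals. -/
theorem tendsto_integral_comp_pathInt (hd : 3 ≤ d) (hv : Measurable v)
    (hC : ∀ z, |v z| ≤ C) (hR : ∀ z, v z ≠ 0 → ‖z‖ ≤ R)
    {x : ℕ → Euc d} {W : ℕ → ℝ → Ω → Euc d} (hW : ∀ n, IsBrownianMotion (x n) (W n))
    (hY : IsBrownianMotion b Y) (hx : Tendsto x atTop (𝓝 b))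
    {t : ℕ → ℝ} (ht : Tendsto t atTop atTop)
    (hβ : 0 ≤ β) (hββ' : β < β') (hK : 0 ≤ K)
    (hintW : ∀ n, Integrable (fun ω => Real.exp (β * ∫ s in Set.Ioi (0 : ℝ), |v (W n s ω)|))
      (ℙ : Measure Ω))
    (hintY : Integrable (fun ω => Real.exp (β * ∫ s in Set.Ioi (0 : ℝ), |v (Y s ω)|))
      (ℙ : Measure Ω))
    (hintY' : Integrable (fun ω => Real.exp (β' * ∫ s in Set.Ioi (0 : ℝ), |v (Y s ω)|))
      (ℙ : Measure Ω))
    (hf : Continuous f) (hfK : ∀ y, |f y| ≤ K * Real.exp (β * |y|))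
    (hfL : ∀ A y z, |y| ≤ A → |z| ≤ A → |f y - f z| ≤ K * |y - z| * Real.exp (β * A)) :
    Tendsto (fun n => ∫ ω, f (pathInt v (W n) (t n) ω)) atTop
      (𝓝 (∫ ω, f (pathIntInf v Y ω))) := by
  have hC0 : 0 ≤ C := (abs_nonneg _).trans (hC 0)
  obtain ⟨B, hB0, hB⟩ : ∃ B, 0 ≤ B ∧ ∀ᶠ n in atTop,
      ∫ ω, Real.exp (β * ∫ s in Set.Ioc 0 (t n), |v (W n s ω)|) ≤ B := by
    have hlim := tendsto_integral_comp_setIntegral_Ioc (v := fun z => |v z|) (C := C) (R := R)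
      (f := fun y => Real.exp (β * y)) (K := 1) hd hv.norm (by simpa using hC)
      (by simpa using hR) one_pos hW hY hx ht hβ hββ' (by simpa using hintY') (by fun_prop)
      fun y => by
        rw [abs_of_pos (Real.exp_pos _), one_mul]
        gcongr
        exact le_abs_self y
    set L := ∫ ω, Real.exp (β * ∫ s in Set.Ioi 1, |v (Y s ω)|)
    have hL : 0 ≤ L := integral_nonneg fun _ => (Real.exp_pos _).le
    refine ⟨Real.exp (β * C) * (L + 1), by positivity, ?_⟩
    filter_upwards [hlim.eventually_le_const (lt_add_one L)] with n hn
    refine le_trans ?_ (mul_le_mul_of_nonneg_left hn (Real.exp_pos _).le)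
    rw [← integral_const_mul]
    have hae := (hW n).ae_integrableOn_Ioi hd hv hC hR
    have hIoc : Set.Ioc 1 (t n) ⊆ Set.Ioi 0 := fun s hs => one_pos.trans hs.1
    have hbound : Integrable (fun ω => Real.exp (β * C) *
        Real.exp (β * ∫ s in Set.Ioc 1 (t n), |v (W n s ω)|)) (ℙ : Measure Ω) := by
      refine ((hintW n).const_mul (Real.exp (β * C))).mono'
        (((hW n).aestronglyMeasurable_exp hv measurableSet_Ioc hIoc).const_mul _) ?_
      filter_upwards [hae] with ω hω
      rw [Real.norm_of_nonneg (by positivity)]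
      have : ∫ s in Set.Ioc 1 (t n), |v (W n s ω)| ≤ ∫ s in Set.Ioi 0, |v (W n s ω)| :=
        setIntegral_mono_set hω.abs (Eventually.of_forall fun _ => abs_nonneg _)
          hIoc.eventuallyLE
      gcongr
    refine integral_mono_of_nonneg (Eventually.of_forall fun _ => (Real.exp_pos _).le) hbound ?_
    filter_upwards [hae] with ω hω
    rw [← Real.exp_add, ← mul_add]
    gcongr
    have hω' : IntegrableOn (fun s => |v (W n s ω)|) (Set.Ioi 0) := hω.abs
    have hsub : Set.Ioc 0 (t n) \ Set.Ioi 1 ⊆ Set.Ioc (0 : ℝ) 1 :=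
      fun s hs => ⟨hs.1.1, by simpa using hs.2⟩
    rw [← integral_inter_add_sdiff (measurableSet_Ioi (a := (1 : ℝ)))
      (hω'.mono_set Set.Ioc_subset_Ioi_self), add_comm, Set.Ioc_inter_Ioi,
      max_eq_right zero_le_one]
    gcongr
    have hvol : volume (Set.Ioc 0 (t n) \ Set.Ioi 1) < ⊤ :=
      (measure_mono hsub).trans_lt measure_Ioc_lt_top
    refine (le_abs_self _).trans ((norm_setIntegral_le_of_norm_le_const
      (f := fun s => |v (W n s ω)|) (C := C) hvol fun s _ => by simpa using hC _).trans ?_)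
    refine (mul_le_mul_of_nonneg_left (measureReal_mono hsub (by simp)) hC0).trans ?_
    simp
  set B' := ∫ ω, Real.exp (β * ∫ s in Set.Ioi (0 : ℝ), |v (Y s ω)|) with hB'
  have hB'0 : 0 ≤ B' := integral_nonneg fun _ => (Real.exp_pos _).le
  rw [Metric.tendsto_nhds]
  intro δ hδ
  obtain ⟨ε, hε, hεδ⟩ : ∃ ε, 0 < ε ∧ K * (C * ε) * B + K * (C * ε) * B' < δ / 2 := by
    have hD : 0 < K * C * (B + B') + 1 := by positivity
    refine ⟨δ / (2 * (K * C * (B + B') + 1)), by positivity, ?_⟩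
    have heq : K * (C * (δ / (2 * (K * C * (B + B') + 1)))) * B +
        K * (C * (δ / (2 * (K * C * (B + B') + 1)))) * B' =
        K * C * (B + B') * (δ / 2) / (K * C * (B + B') + 1) := by
      field_simp
    rw [heq, div_lt_iff₀ hD]
    nlinarith
  have hmid := Metric.tendsto_nhds.1 (tendsto_integral_comp_setIntegral_Ioc hd hv hC hR hε hW hY
    hx ht hβ hββ' hintY' hf hfK) (δ / 2) (half_pos hδ)
  have hlast := hY.abs_integral_sub_integral_le hd hv hC hR hε.le measurableSet_Ioi subset_rfl
    hβ hK hintY hf hfK hfL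
  rw [Set.Ioi_inter_Ioi, max_eq_right hε.le] at hlast
  filter_upwards [hB, hmid] with n hBn hmidn
  have hfirst := (hW n).abs_integral_sub_integral_le hd hv hC hR hε.le
    (measurableSet_Ioc (a := 0) (b := t n)) Set.Ioc_subset_Ioi_self hβ hK (hintW n) hf hfK hfL
  rw [Set.Ioc_inter_Ioi, max_eq_right hε.le] at hfirst
  have hfirst' := hfirst.trans (mul_le_mul_of_nonneg_left hBn (by positivity))
  rw [Real.dist_eq, abs_lt] at hmidn ⊢
  rw [abs_le] at hfirst' hlast
  simp only [pathInt, pathIntInf]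
  constructor <;> linarith [hfirst'.1, hfirst'.2, hlast.1, hlast.2, hmidn.1, hmidn.2]

end Convergence

theorem pow_le_const_mul_exp {β : ℝ} (hβ : 0 < β) (k : ℕ) {A : ℝ} (hA : 0 ≤ A) :
    A ^ k ≤ k.factorial / β ^ k * Real.exp (β * A) := by
  have h := Real.pow_div_factorial_le_exp (β * A) (by positivity) k
  rw [mul_pow, div_le_iff₀ (by positivity)] at h
  rw [div_mul_eq_mul_div, le_div_iff₀ (by positivity)]
  linarith

theorem abs_pow_sub_pow_le_exp {β : ℝ} (hβ : 0 < β) (k : ℕ) {A y z : ℝ} (hy : |y| ≤ A)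
    (hz : |z| ≤ A) : |y ^ k - z ^ k| ≤
      k * ((k - 1).factorial / β ^ (k - 1)) * |y - z| * Real.exp (β * A) := by
  have hA : 0 ≤ A := (abs_nonneg y).trans hy
  calc |y ^ k - z ^ k| ≤ |y - z| * k * max |y| |z| ^ (k - 1) := abs_pow_sub_pow_le ..
    _ ≤ |y - z| * k * A ^ (k - 1) := by
        gcongr
        exact max_le hy hz
    _ ≤ |y - z| * k * ((k - 1).factorial / β ^ (k - 1) * Real.exp (β * A)) := by
        gcongr
        exact pow_le_const_mul_exp hβ _ hA
    _ = _ := by ring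

theorem abs_exp_mul_sub_exp_mul_le (α : ℝ) {A y z : ℝ} (hy : |y| ≤ A) (hz : |z| ≤ A) :
    |Real.exp (α * y) - Real.exp (α * z)| ≤ |α| * |y - z| * Real.exp (|α| * A) := by
  have key : ∀ u w : ℝ, |u| ≤ |α| * A →
      Real.exp u - Real.exp w ≤ |u - w| * Real.exp (|α| * A) := by
    intro u w hu
    have h1 : Real.exp u - Real.exp w ≤ (u - w) * Real.exp u := by
      have h := Real.add_one_le_exp (w - u)
      have hw : Real.exp w = Real.exp (w - u) * Real.exp u := by
        rw [← Real.exp_add, sub_add_cancel]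
      rw [hw]
      nlinarith [Real.exp_pos u]
    refine h1.trans ?_
    gcongr
    · exact le_abs_self _
    · exact (le_abs_self u).trans hu
  have hbound : ∀ y : ℝ, |y| ≤ A → |α * y| ≤ |α| * A := fun y hy => by
    rw [abs_mul]
    gcongr
  rw [← abs_mul, mul_sub, abs_sub_le_iff]
  refine ⟨key _ _ (hbound y hy), ?_⟩
  rw [abs_sub_comm]
  exact key _ _ (hbound z hz)

/-- Lemma 4(a): convergence of moments and of the m.g.f. of the truncated path integral
as the starting points converge and the time horizons diverge. -/
theorem stmt7 (d : ℕ) (hd : 3 ≤ d) (v : Euc d → ℝ)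
    (hvm : Measurable v) (hvb : ∃ C : ℝ, ∀ z, |v z| ≤ C)
    (hvs : ∃ R : ℝ, ∀ z, v z ≠ 0 → ‖z‖ ≤ R)
    {Ω : Type*} [MeasureSpace Ω] [IsProbabilityMeasure (ℙ : Measure Ω)]
    (W : Euc d → ℝ → Ω → Euc d) (hW : ∀ a, IsBrownianMotion a (W a))
    (α₀ : ℝ) (hα₀ : 0 < α₀)
    (hexp : ∀ (a : Euc d) (α : ℝ), |α| < α₀ →
      (∫⁻ ω, ENNReal.ofReal (Real.exp (α * ∫ s in Set.Ioi (0 : ℝ), |v (W a s ω)|))) ≠ ⊤)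
    (x : ℕ → Euc d) (t : ℕ → ℝ) (xlim : Euc d)
    (hx : Tendsto x atTop (𝓝 xlim)) (ht : Tendsto t atTop atTop) :
    (∀ k : ℕ, Tendsto (fun n => ∫ ω, (pathInt v (W (x n)) (t n) ω) ^ k) atTop
      (𝓝 (∫ ω, (pathIntInf v (W xlim) ω) ^ k))) ∧
    (∀ α : ℝ, |α| < α₀ →
      Tendsto (fun n => ∫ ω, Real.exp (α * pathInt v (W (x n)) (t n) ω)) atTop
        (𝓝 (∫ ω, Real.exp (α * pathIntInf v (W xlim) ω)))) := by
  obtain ⟨C, hC⟩ := hvb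
  obtain ⟨R, hR⟩ := hvs
  have hInt : ∀ (a : Euc d) (β : ℝ), 0 ≤ β → β < α₀ →
      Integrable (fun ω => Real.exp (β * ∫ s in Set.Ioi (0 : ℝ), |v (W a s ω)|))
        (ℙ : Measure Ω) := fun a β hβ hβα =>
    (hW a).integrable_exp_of_lintegral_ne_top hvm (hexp a β (by rwa [abs_of_nonneg hβ]))
  have main : ∀ (β K : ℝ) (f : ℝ → ℝ), 0 ≤ β → β < α₀ → 0 ≤ K → Continuous f →
      (∀ y, |f y| ≤ K * Real.exp (β * |y|)) →
      (∀ A y z, |y| ≤ A → |z| ≤ A → |f y - f z| ≤ K * |y - z| * Real.exp (β * A)) →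
      Tendsto (fun n => ∫ ω, f (pathInt v (W (x n)) (t n) ω)) atTop
        (𝓝 (∫ ω, f (pathIntInf v (W xlim) ω))) := by
    intro β K f hβ hβα hK hf hfK hfL
    obtain ⟨β', hββ', hβ'α⟩ := exists_between hβα
    exact tendsto_integral_comp_pathInt hd hvm hC hR (fun n => hW (x n)) (hW xlim) hx ht hβ hββ'
      hK (fun n => hInt _ _ hβ hβα) (hInt _ _ hβ hβα) (hInt _ _ (hβ.trans hββ'.le) hβ'α) hf hfK hfL
  refine ⟨fun k => ?_, fun α hα => ?_⟩
  · have hβ : 0 < α₀ / 2 := by positivity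
    set K₁ : ℝ := k.factorial / (α₀ / 2) ^ k
    set K₂ : ℝ := k * ((k - 1).factorial / (α₀ / 2) ^ (k - 1))
    have hK₁ : 0 ≤ K₁ := by positivity
    have hK₂ : 0 ≤ K₂ := by positivity
    refine main (α₀ / 2) (K₁ + K₂) (fun y => y ^ k) hβ.le (half_lt_self hα₀) (by positivity)
      (continuous_pow k) (fun y => ?_) fun A y z hy hz => ?_
    · rw [abs_pow]
      refine (pow_le_const_mul_exp hβ k (abs_nonneg y)).trans ?_
      gcongr
      exact le_add_of_nonneg_right hK₂
    · refine (abs_pow_sub_pow_le_exp hβ k hy hz).trans ?_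
      gcongr
      exact le_add_of_nonneg_left hK₁
  · refine main |α| (1 + |α|) (fun y => Real.exp (α * y)) (abs_nonneg α) hα (by positivity)
      (by fun_prop) (fun y => ?_) fun A y z hy hz => ?_
    · rw [abs_of_pos (Real.exp_pos _), ← abs_mul]
      refine (Real.exp_le_exp.2 (le_abs_self _)).trans (le_mul_of_one_le_left
        (Real.exp_pos _).le ?_)
      linarith [abs_nonneg α]
    · refine (abs_exp_mul_sub_exp_mul_le α hy hz).trans ?_
      gcongr
      linarith

end
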